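/- arXiv:1808.06944 — 2 statements merged into one kernel-verified Lean document; each statement's English description precedes it below -/
import Mathlib

section
/- Consider the linear heat equation with Dirichlet boundary input: ∂x/∂t(t,z) = Δx(t,z) + a·x(t,z) on (0,∞) × G, x(t,z) = u(t,z) on (0,∞) × ∂G, x(0,z) = x₀(z) on closure(G), where a ∈ ℝ and G ⊂ ℝⁿ is an open bounded connected set with smooth boundary satisfying hypothesis (H3) for the state space X described below. Then the associated control system is exp-ISS with a linear gain function if and only if it is 0-UGAS, i.e. if and only if there exists β of class KL such that ‖φ(t,x₀,0)‖_p ≤ β(‖x₀‖_p, t) for every x₀ ∈ X with 0 ∈ A(x₀) and every t ≥ 0. -/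
open Filter Set MeasureTheory ENNReal

noncomputable section

/-- `γ` is of class `K`: continuous, strictly increasing on `[0,∞)` with `γ(0) = 0`. -/
def ClassK (γ : ℝ → ℝ) : Prop :=
  ContinuousOn γ (Ici 0) ∧ StrictMonoOn γ (Ici 0) ∧ γ 0 = 0

/-- `γ` is of class `K∞`: of class `K` and unbounded. -/
def ClassKInf (γ : ℝ → ℝ) : Prop :=
  ClassK γ ∧ Tendsto γ atTop atTop

/-- `β` is of class `KL`. -/
def ClassKL (β : ℝ → ℝ → ℝ) : Prop :=
  ContinuousOn (fun q : ℝ × ℝ => β q.1 q.2) (Ici 0 ×ˢ Ici 0) ∧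
  (∀ t ≥ (0:ℝ), ClassK fun r => β r t) ∧
  (∀ r > (0:ℝ), StrictAntiOn (fun t => β r t) (Ici 0) ∧
    Tendsto (fun t => β r t) atTop (nhds 0))

/-- The `i`-th coordinate direction in `ℝⁿ`. -/
def edir (n : ℕ) (i : Fin n) : EuclideanSpace ℝ (Fin n) := EuclideanSpace.single i (1:ℝ)

/-- Second partial derivative `∂²u/(∂z_i ∂z_j)` at `z`. -/
def pder2 {n : ℕ} (u : EuclideanSpace ℝ (Fin n) → ℝ) (z : EuclideanSpace ℝ (Fin n))
    (i j : Fin n) : ℝ :=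
  fderiv ℝ (fun w => fderiv ℝ u w (edir n i)) z (edir n j)

/-- Gradient `∇u(z)`, viewed as a vector of `ℝⁿ`. -/
def grad {n : ℕ} (u : EuclideanSpace ℝ (Fin n) → ℝ) (z : EuclideanSpace ℝ (Fin n)) :
    EuclideanSpace ℝ (Fin n) :=
  (WithLp.equiv 2 (Fin n → ℝ)).symm fun i => fderiv ℝ u z (edir n i)

/-- The parabolic operator
`(Lx)(t,z) = ∂x/∂t(t,z) − Σ_{i,j} a_{ij}(z) ∂²x/(∂z_i∂z_j)(t,z) − f(z, x(t,z), ∇_z x(t,z))`. -/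
def Lop {n : ℕ} (a : Fin n → Fin n → EuclideanSpace ℝ (Fin n) → ℝ)
    (f : EuclideanSpace ℝ (Fin n) → ℝ → EuclideanSpace ℝ (Fin n) → ℝ)
    (x : ℝ → EuclideanSpace ℝ (Fin n) → ℝ) (t : ℝ) (z : EuclideanSpace ℝ (Fin n)) : ℝ :=
  deriv (fun s => x s z) t
    - ∑ i, ∑ j, a i j z * pder2 (x t) z i j
    - f z (x t z) (grad (x t) z)

/-- `x ∈ C^{1,2}(D)`: once continuously differentiable in `t` and twice continuously
differentiable in `z` on `D`. -/
def C12On {n : ℕ} (x : ℝ → EuclideanSpace ℝ (Fin n) → ℝ)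
    (D : Set (ℝ × EuclideanSpace ℝ (Fin n))) : Prop :=
  (∀ p ∈ D, DifferentiableAt ℝ (fun s => x s p.2) p.1) ∧
  ContinuousOn (fun p : ℝ × EuclideanSpace ℝ (Fin n) => deriv (fun s => x s p.2) p.1) D ∧
  (∀ p ∈ D, DifferentiableAt ℝ (x p.1) p.2) ∧
  (∀ p ∈ D, DifferentiableAt ℝ (fun w => fderiv ℝ (x p.1) w) p.2) ∧
  ContinuousOn
    (fun p : ℝ × EuclideanSpace ℝ (Fin n) => fderiv ℝ (fun w => fderiv ℝ (x p.1) w) p.2) D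


/-- The Laplacian in the spatial variable: `Δu(z) = Σ_i ∂²u/∂z_i²`. -/
def lap {n : ℕ} (u : EuclideanSpace ℝ (Fin n) → ℝ) (z : EuclideanSpace ℝ (Fin n)) : ℝ :=
  ∑ i, pder2 u z i i

/-- A boundary input: a bounded continuous function on `ℝ≥0 × ∂G`. -/
def IsBdryInput {n : ℕ} (G : Set (EuclideanSpace ℝ (Fin n)))
    (u : ℝ → EuclideanSpace ℝ (Fin n) → ℝ) : Prop :=
  ContinuousOn (fun q : ℝ × EuclideanSpace ℝ (Fin n) => u q.1 q.2) (Ici 0 ×ˢ frontier G) ∧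
  ∃ C : ℝ, ∀ t ≥ (0:ℝ), ∀ z ∈ frontier G, |u t z| ≤ C

/-- The `L^p(G)` norm of a state. -/
def Xnorm {n : ℕ} (G : Set (EuclideanSpace ℝ (Fin n))) (p : ℝ≥0∞)
    (x : EuclideanSpace ℝ (Fin n) → ℝ) : ℝ :=
  (eLpNorm x p (volume.restrict G)).toReal

/-- The sup-norm `sup_{t ≥ 0, z ∈ ∂G} |u(t,z)|` of a boundary input. -/
def bdryNorm {n : ℕ} (G : Set (EuclideanSpace ℝ (Fin n)))
    (u : ℝ → EuclideanSpace ℝ (Fin n) → ℝ) : ℝ :=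
  sSup ((fun q : ℝ × EuclideanSpace ℝ (Fin n) => |u q.1 q.2|) '' (Ici 0 ×ˢ frontier G))

/-- Classical solution of the heat equation, without initial and boundary conditions. -/
def IsSolH {n : ℕ} (G : Set (EuclideanSpace ℝ (Fin n))) (a : ℝ)
    (y : ℝ → EuclideanSpace ℝ (Fin n) → ℝ) : Prop :=
  ContinuousOn (fun q : ℝ × EuclideanSpace ℝ (Fin n) => y q.1 q.2) (Ici 0 ×ˢ closure G) ∧
  C12On y (Ioi 0 ×ˢ G) ∧
  (∀ t > (0:ℝ), ∀ z ∈ G, deriv (fun s => y s z) t = lap (y t) z + a * y t z)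

lemma lap_eq {n : ℕ} {u : EuclideanSpace ℝ (Fin n) → ℝ} {z : EuclideanSpace ℝ (Fin n)}
    (h : DifferentiableAt ℝ (fun w => fderiv ℝ u w) z) :
    lap u z = ∑ i, fderiv ℝ (fun w => fderiv ℝ u w) z (edir n i) (edir n i) := by
  unfold lap pder2
  refine Finset.sum_congr rfl fun i _ => ?_
  rw [fderiv_clm_apply h (differentiableAt_const _)]
  simp

lemma second_le {n : ℕ} {u : EuclideanSpace ℝ (Fin n) → ℝ} {z e : EuclideanSpace ℝ (Fin n)}
    (hd : ∀ᶠ w in nhds z, DifferentiableAt ℝ u w)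
    (h : DifferentiableAt ℝ (fun w => fderiv ℝ u w) z) (hm : IsLocalMax u z) :
    fderiv ℝ (fun w => fderiv ℝ u w) z e e ≤ 0 := by
  by_contra hpos
  push Not at hpos
  set g : ℝ → ℝ := fun s => u (z + s • e) with hg
  have hline : ∀ s : ℝ, HasDerivAt (fun s : ℝ => z + s • e) e s := fun s => by
    simpa using ((hasDerivAt_id s).smul_const e).const_add z
  have hcont : Tendsto (fun s : ℝ => z + s • e) (nhds 0) (nhds z) := by
    have := (hline 0).continuousAt
    simpa [ContinuousAt] using this
  have hg' : ∀ᶠ s in nhds (0:ℝ), HasDerivAt g (fderiv ℝ u (z + s • e) e) s := by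
    filter_upwards [hcont.eventually hd] with s hs
    exact hs.hasFDerivAt.comp_hasDerivAt s (hline s)
  have hdg : deriv g =ᶠ[nhds 0] fun s => fderiv ℝ u (z + s • e) e := by
    filter_upwards [hg'] with s hs using hs.deriv
  have h2 : HasDerivAt (fun s : ℝ => fderiv ℝ u (z + s • e) e)
      (fderiv ℝ (fun w => fderiv ℝ u w) z e e) 0 := by
    have h0 : HasFDerivAt (fun w => fderiv ℝ u w) (fderiv ℝ (fun w => fderiv ℝ u w) z)
        (z + (0:ℝ) • e) := by simpa using h.hasFDerivAt
    have := h0.comp_hasDerivAt (0:ℝ) (hline 0)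
    simpa using this.clm_apply (hasDerivAt_const (0:ℝ) e)
  have hdd : deriv (deriv g) 0 = fderiv ℝ (fun w => fderiv ℝ u w) z e e := by
    rw [hdg.deriv_eq, h2.deriv]
  have hmax : IsLocalMax g 0 := by
    have := hcont.eventually hm
    filter_upwards [this] with s hs
    simpa [hg] using hs
  have hd0 : deriv g 0 = 0 := hmax.deriv_eq_zero
  have hmin : IsLocalMin g 0 :=
    isLocalMin_of_deriv_deriv_pos (by rw [hdd]; exact hpos) hd0 hg'.self_of_nhds.continuousAt
  have hc : g =ᶠ[nhds 0] fun _ => g 0 := by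
    filter_upwards [hmax, hmin] with s h1 h2 using le_antisymm h1 h2
  have hc' : deriv g =ᶠ[nhds 0] fun _ => 0 := by
    have := hc.deriv
    filter_upwards [this] with s hs
    rw [hs]; simp
  have : deriv (deriv g) 0 = 0 := by rw [hc'.deriv_eq]; simp
  rw [hdd] at this
  exact absurd this hpos.ne'

lemma max_principle {n : ℕ} {G : Set (EuclideanSpace ℝ (Fin n))}
    (hGopen : IsOpen G) (hGbdd : Bornology.IsBounded G) {a : ℝ}
    {v : ℝ → EuclideanSpace ℝ (Fin n) → ℝ} (hv : IsSolH G a v)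
    (h0 : ∀ z ∈ closure G, v 0 z ≤ 0)
    (hb : ∀ t ≥ (0:ℝ), ∀ z ∈ frontier G, v t z ≤ 0) :
    ∀ t ≥ (0:ℝ), ∀ z ∈ closure G, v t z ≤ 0 := by
  obtain ⟨hc, ⟨hd1, -, hd2, hd3, -⟩, hpde⟩ := hv
  intro T hT z₁ hz₁
  by_contra hpos
  push Not at hpos
  have hcpt : IsCompact (Icc (0:ℝ) T ×ˢ closure G) :=
    isCompact_Icc.prod hGbdd.isCompact_closure
  have hW : ContinuousOn (fun q : ℝ × EuclideanSpace ℝ (Fin n) =>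
      Real.exp (-(a+1) * q.1) * v q.1 q.2) (Icc (0:ℝ) T ×ˢ closure G) := by
    apply ContinuousOn.mul
    · fun_prop
    · exact hc.mono (prod_mono Icc_subset_Ici_self subset_rfl)
  obtain ⟨⟨t, z⟩, ⟨ht, hz⟩, hmax⟩ := hcpt.exists_isMaxOn ⟨(T, z₁), ⟨⟨hT, le_rfl⟩, hz₁⟩⟩ hW
  simp only at ht hz
  have hmax' : ∀ s ∈ Icc (0:ℝ) T, ∀ w ∈ closure G,
      Real.exp (-(a+1) * s) * v s w ≤ Real.exp (-(a+1) * t) * v t z :=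
    fun s hs w hw => hmax (a := (s, w)) ⟨hs, hw⟩
  have hvpos : 0 < v t z := by
    have h1 := hmax' T ⟨hT, le_rfl⟩ z₁ hz₁
    have h2 : 0 < Real.exp (-(a+1) * T) * v T z₁ := by positivity
    exact pos_of_mul_pos_right (h2.trans_le h1) (Real.exp_pos _).le
  have ht0 : 0 < t := by
    rcases ht.1.eq_or_lt with h | h
    · rw [← h] at hvpos; exact absurd (h0 z hz) (not_le.2 hvpos)
    · exact h
  have hzG : z ∈ G := by
    by_contra hzn
    have : z ∈ frontier G := by rw [hGopen.frontier_eq]; exact ⟨hz, hzn⟩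
    exact absurd (hb t ht0.le z this) (not_le.2 hvpos)
  have hmem : ((t, z) : ℝ × EuclideanSpace ℝ (Fin n)) ∈ Ioi (0:ℝ) ×ˢ G := ⟨ht0, hzG⟩
  have hlap : lap (v t) z ≤ 0 := by
    rw [lap_eq (hd3 _ hmem)]
    refine Finset.sum_nonpos fun i _ => second_le ?_ (hd3 _ hmem) ?_
    · filter_upwards [hGopen.mem_nhds hzG] with w hw using hd2 (t, w) ⟨ht0, hw⟩
    · filter_upwards [hGopen.mem_nhds hzG] with w hw
      exact le_of_mul_le_mul_left (hmax' t ht w (subset_closure hw)) (Real.exp_pos _)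
  have hder := (hd1 _ hmem).hasDerivAt
  simp only at hder
  have hexp : HasDerivAt (fun s : ℝ => Real.exp (-(a+1) * s))
      (Real.exp (-(a+1) * t) * (-(a+1))) t := by
    simpa using ((hasDerivAt_id t).const_mul (-(a+1))).exp
  have hprod := hexp.mul hder
  have hnn : 0 ≤ Real.exp (-(a+1) * t) * (-(a+1)) * v t z +
      Real.exp (-(a+1) * t) * deriv (fun s => v s z) t := by
    have htend := hprod.tendsto_slope
    have htend' : Tendsto _ (nhdsWithin t (Iio t)) _ :=
      htend.mono_left (nhdsWithin_mono _ (fun s hs => ne_of_lt hs))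
    refine ge_of_tendsto htend' ?_
    filter_upwards [Ioo_mem_nhdsLT ht0] with s hs
    rw [slope_def_field]
    apply div_nonneg_of_nonpos
    · have := hmax' s ⟨hs.1.le, hs.2.le.trans ht.2⟩ z hz
      simpa using this
    · linarith [hs.2]
  have h3 : 0 ≤ Real.exp (-(a+1) * t) * (deriv (fun s => v s z) t - (a+1) * v t z) := by
    linarith
  have h4 := nonneg_of_mul_nonneg_right h3 (Real.exp_pos _)
  rw [hpde t ht0 z hzG] at h4
  linarith

lemma IsSolH.smul {n : ℕ} {G : Set (EuclideanSpace ℝ (Fin n))} {a : ℝ}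
    {y : ℝ → EuclideanSpace ℝ (Fin n) → ℝ} (hy : IsSolH G a y) (c : ℝ) :
    IsSolH G a (fun t z => c * y t z) := by
  obtain ⟨hc, ⟨h1, h2, h3, h4, h5⟩, hp⟩ := hy
  have e1 : ∀ t, (fun w => fderiv ℝ (fun z => c * y t z) w) = fun w => c • fderiv ℝ (y t) w := by
    intro t; funext w
    exact congrFun (fderiv_const_smul_field (𝕜 := ℝ) (f := y t) c) w
  have e2 : ∀ t z, fderiv ℝ (fun w => fderiv ℝ (fun z => c * y t z) w) z =
      c • fderiv ℝ (fun w => fderiv ℝ (y t) w) z := by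
    intro t z; rw [e1]
    exact congrFun (fderiv_const_smul_field (𝕜 := ℝ) (f := fun w => fderiv ℝ (y t) w) c) z
  have e3 : ∀ t z, deriv (fun s => c * y s z) t = c * deriv (fun s => y s z) t := by
    intro t z; simp
  have d4 : ∀ p ∈ Ioi (0:ℝ) ×ˢ G,
      DifferentiableAt ℝ (fun w => fderiv ℝ (fun z => c * y p.1 z) w) p.2 := by
    intro p hp; rw [e1]; exact (h4 p hp).const_smul c
  refine ⟨continuousOn_const.mul hc, ⟨fun p hp => (h1 p hp).const_mul c, ?_,
    fun p hp => (h3 p hp).const_mul c, d4, ?_⟩, ?_⟩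
  · simp only [e3]; exact continuousOn_const.mul h2
  · simp only [e2]; exact h5.const_smul c
  · intro t ht z hz
    rw [e3, hp t ht z hz, lap_eq (d4 (t, z) ⟨ht, hz⟩), lap_eq (h4 (t, z) ⟨ht, hz⟩)]
    simp only [e2]
    rw [mul_add, Finset.mul_sum]
    simp; ring

lemma IsSolH.add {n : ℕ} {G : Set (EuclideanSpace ℝ (Fin n))} (hG : IsOpen G) {a : ℝ}
    {y x : ℝ → EuclideanSpace ℝ (Fin n) → ℝ} (hy : IsSolH G a y) (hx : IsSolH G a x) :
    IsSolH G a (fun t z => y t z + x t z) := by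
  obtain ⟨hc, ⟨h1, h2, h3, h4, h5⟩, hp⟩ := hy
  obtain ⟨hc', ⟨h1', h2', h3', h4', h5'⟩, hp'⟩ := hx
  have e1 : ∀ p ∈ Ioi (0:ℝ) ×ˢ G, (fun w => fderiv ℝ (fun z => y p.1 z + x p.1 z) w) =ᶠ[nhds p.2]
      fun w => fderiv ℝ (y p.1) w + fderiv ℝ (x p.1) w := by
    intro p hp
    filter_upwards [hG.mem_nhds hp.2] with w hw
    exact fderiv_add (h3 (p.1, w) ⟨hp.1, hw⟩) (h3' (p.1, w) ⟨hp.1, hw⟩)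
  have e2 : ∀ p ∈ Ioi (0:ℝ) ×ˢ G, fderiv ℝ (fun w => fderiv ℝ (fun z => y p.1 z + x p.1 z) w) p.2 =
      fderiv ℝ (fun w => fderiv ℝ (y p.1) w) p.2 + fderiv ℝ (fun w => fderiv ℝ (x p.1) w) p.2 := by
    intro p hp
    rw [(e1 p hp).fderiv_eq]
    exact fderiv_add (h4 p hp) (h4' p hp)
  have e3 : ∀ p ∈ Ioi (0:ℝ) ×ˢ G, deriv (fun s => y s p.2 + x s p.2) p.1 =
      deriv (fun s => y s p.2) p.1 + deriv (fun s => x s p.2) p.1 := by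
    intro p hp; exact deriv_add (h1 p hp) (h1' p hp)
  have d4 : ∀ p ∈ Ioi (0:ℝ) ×ˢ G,
      DifferentiableAt ℝ (fun w => fderiv ℝ (fun z => y p.1 z + x p.1 z) w) p.2 := by
    intro p hp
    exact ((h4 p hp).add (h4' p hp)).congr_of_eventuallyEq (e1 p hp)
  refine ⟨hc.add hc', ⟨fun p hp => (h1 p hp).add (h1' p hp), (h2.add h2').congr e3,
    fun p hp => (h3 p hp).add (h3' p hp), d4, (h5.add h5').congr e2⟩, ?_⟩
  intro t ht z hz
  have hm : ((t, z) : ℝ × EuclideanSpace ℝ (Fin n)) ∈ Ioi (0:ℝ) ×ˢ G := ⟨ht, hz⟩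
  have q3 := e3 _ hm
  have q2 := e2 _ hm
  simp only at q3 q2
  rw [q3, hp t ht z hz, hp' t ht z hz, lap_eq (d4 _ hm), lap_eq (h4 _ hm), lap_eq (h4' _ hm)]
  simp only [q2]
  simp [Finset.sum_add_distrib]; ring

lemma IsSolH.shift {n : ℕ} {G : Set (EuclideanSpace ℝ (Fin n))} {a : ℝ}
    {y : ℝ → EuclideanSpace ℝ (Fin n) → ℝ} (hy : IsSolH G a y) {T : ℝ} (hT : 0 ≤ T) :
    IsSolH G a (fun t z => y (t + T) z) := by
  obtain ⟨hc, ⟨h1, h2, h3, h4, h5⟩, hp⟩ := hy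
  have e3 : ∀ t z, deriv (fun s => y (s + T) z) t = deriv (fun s => y s z) (t + T) := by
    intro t z; exact deriv_comp_add_const (f := fun s => y s z) T t
  have hm : ∀ p ∈ Ioi (0:ℝ) ×ˢ G, ((p.1 + T, p.2) : ℝ × EuclideanSpace ℝ (Fin n)) ∈
      Ioi (0:ℝ) ×ˢ G := fun p hp => ⟨by have := hp.1; simp only [mem_Ioi] at *; linarith, hp.2⟩
  have hcs : Continuous (fun p : ℝ × EuclideanSpace ℝ (Fin n) => (p.1 + T, p.2)) := by fun_prop
  refine ⟨?_, ⟨?_, ?_, fun p hp => h3 _ (hm p hp), fun p hp => h4 _ (hm p hp), ?_⟩, ?_⟩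
  · refine hc.comp hcs.continuousOn fun p hp => ⟨?_, hp.2⟩
    have := hp.1; simp only [mem_Ici] at *; linarith
  · intro p hp
    have := h1 _ (hm p hp)
    exact DifferentiableAt.comp (g := fun s => y s p.2) p.1 this (by fun_prop)
  · simp only [e3]; exact h2.comp hcs.continuousOn hm
  · exact h5.comp hcs.continuousOn hm
  · intro t ht z hz
    rw [e3]; exact hp _ (by linarith) z hz

lemma IsSolH.slice {n : ℕ} {G : Set (EuclideanSpace ℝ (Fin n))} {a : ℝ}
    {y : ℝ → EuclideanSpace ℝ (Fin n) → ℝ} (hy : IsSolH G a y) {t : ℝ} (ht : 0 ≤ t) :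
    ContinuousOn (y t) (closure G) :=
  hy.1.comp (f := fun z => (t, z)) (by fun_prop) fun z hz => ⟨ht, hz⟩

lemma memLp_of_cont {n : ℕ} {G : Set (EuclideanSpace ℝ (Fin n))} (hG : IsOpen G)
    (hb : Bornology.IsBounded G) (p : ℝ≥0∞) {x : EuclideanSpace ℝ (Fin n) → ℝ}
    (hx : ContinuousOn x (closure G)) : MemLp x p (volume.restrict G) := by
  have : IsFiniteMeasure (volume.restrict G) :=
    ⟨by rw [Measure.restrict_apply_univ]; exact hb.measure_lt_top⟩
  obtain ⟨C, hC⟩ := hb.isCompact_closure.exists_bound_of_continuousOn hx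
  refine MemLp.of_bound ((hx.mono subset_closure).aestronglyMeasurable hG.measurableSet) C ?_
  filter_upwards [ae_restrict_mem hG.measurableSet] with z hz using hC z (subset_closure hz)

lemma Xnorm_congr {n : ℕ} {G : Set (EuclideanSpace ℝ (Fin n))} (hG : IsOpen G) (p : ℝ≥0∞)
    {x y : EuclideanSpace ℝ (Fin n) → ℝ} (h : ∀ z ∈ closure G, x z = y z) :
    Xnorm G p x = Xnorm G p y := by
  unfold Xnorm
  rw [eLpNorm_congr_ae]
  filter_upwards [ae_restrict_mem hG.measurableSet] with z hz using h z (subset_closure hz)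

lemma Xnorm_mono {n : ℕ} {G : Set (EuclideanSpace ℝ (Fin n))} (hG : IsOpen G)
    (hb : Bornology.IsBounded G) (p : ℝ≥0∞)
    {x y : EuclideanSpace ℝ (Fin n) → ℝ} (hy : ContinuousOn y (closure G))
    (h : ∀ z ∈ closure G, |x z| ≤ |y z|) :
    Xnorm G p x ≤ Xnorm G p y := by
  unfold Xnorm
  refine ENNReal.toReal_mono (memLp_of_cont hG hb p hy).eLpNorm_ne_top ?_
  apply eLpNorm_mono_ae
  filter_upwards [ae_restrict_mem hG.measurableSet] with z hz using h z (subset_closure hz)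

lemma Xnorm_add {n : ℕ} {G : Set (EuclideanSpace ℝ (Fin n))} (hG : IsOpen G)
    (hb : Bornology.IsBounded G) {p : ℝ≥0∞} (hp : 1 ≤ p)
    {x y : EuclideanSpace ℝ (Fin n) → ℝ} (hx : ContinuousOn x (closure G))
    (hy : ContinuousOn y (closure G)) :
    Xnorm G p (fun z => x z + y z) ≤ Xnorm G p x + Xnorm G p y := by
  have h1 := memLp_of_cont hG hb p hx
  have h2 := memLp_of_cont hG hb p hy
  unfold Xnorm
  rw [← ENNReal.toReal_add h1.eLpNorm_ne_top h2.eLpNorm_ne_top]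
  exact ENNReal.toReal_mono (ENNReal.add_ne_top.2 ⟨h1.eLpNorm_ne_top, h2.eLpNorm_ne_top⟩)
    (eLpNorm_add_le h1.1 h2.1 hp)

lemma Xnorm_smul {n : ℕ} (G : Set (EuclideanSpace ℝ (Fin n))) (p : ℝ≥0∞) (c : ℝ)
    (x : EuclideanSpace ℝ (Fin n) → ℝ) :
    Xnorm G p (fun z => c * x z) = |c| * Xnorm G p x := by
  unfold Xnorm
  have := eLpNorm_const_smul c x p (volume.restrict G)
  rw [show (fun z => c * x z) = c • x from rfl, this, ENNReal.toReal_mul]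
  simp

lemma Xnorm_nonneg {n : ℕ} (G : Set (EuclideanSpace ℝ (Fin n))) (p : ℝ≥0∞)
    (x : EuclideanSpace ℝ (Fin n) → ℝ) : 0 ≤ Xnorm G p x := ENNReal.toReal_nonneg

/-- Bound by pointwise domination by a sum of two continuous functions. -/
lemma Xnorm_dom {n : ℕ} {G : Set (EuclideanSpace ℝ (Fin n))} (hG : IsOpen G)
    (hb : Bornology.IsBounded G) {p : ℝ≥0∞} (hp : 1 ≤ p)
    {x y w : EuclideanSpace ℝ (Fin n) → ℝ} (hx : ContinuousOn x (closure G))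
    (hy : ContinuousOn y (closure G)) (h : ∀ z ∈ closure G, |w z| ≤ |x z| + |y z|) :
    Xnorm G p w ≤ Xnorm G p x + Xnorm G p y := by
  have hx' : ContinuousOn (fun z => |x z|) (closure G) := hx.abs
  have hy' : ContinuousOn (fun z => |y z|) (closure G) := hy.abs
  calc Xnorm G p w ≤ Xnorm G p (fun z => |x z| + |y z|) :=
        Xnorm_mono hG hb p (hx'.add hy') fun z hz =>
          (h z hz).trans (le_abs_self _)
    _ ≤ Xnorm G p (fun z => |x z|) + Xnorm G p (fun z => |y z|) := Xnorm_add hG hb hp hx' hy'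
    _ ≤ _ := by
        gcongr
        · exact Xnorm_mono hG hb p hx fun z _ => by simp
        · exact Xnorm_mono hG hb p hy fun z _ => by simp

/-- Exponential decay from uniform decay of a shift-invariant family. -/
lemma exp_decay {F : Type*} (P : (ℝ → F) → Prop) (N : F → ℝ) (hN : ∀ x, 0 ≤ N x)
    (hsh : ∀ y, P y → ∀ T ≥ (0:ℝ), P (fun t => y (t + T)))
    (b : ℝ → ℝ) (B : ℝ) (hB : 0 < B) (hbB : ∀ t ≥ 0, b t ≤ B) (hb0 : Tendsto b atTop (nhds 0))
    (hP : ∀ y, P y → ∀ t ≥ (0:ℝ), N (y t) ≤ b t * N (y 0)) :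
    ∃ M > (0:ℝ), ∃ lam > (0:ℝ), ∀ y, P y → ∀ t ≥ (0:ℝ),
      N (y t) ≤ M * Real.exp (-lam * t) * N (y 0) := by
  obtain ⟨T, hT1, hT⟩ := ((eventually_ge_atTop (1:ℝ)).and
    (hb0.eventually (eventually_le_nhds (show (0:ℝ) < 1/2 by norm_num)))).exists
  have hT0 : 0 < T := by linarith
  have hl2 : 0 < Real.log 2 := Real.log_pos (by norm_num)
  refine ⟨2 * B, by positivity, Real.log 2 / T, by positivity, ?_⟩
  have heT : Real.exp (Real.log 2 / T * T) = 2 := by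
    rw [div_mul_cancel₀ _ hT0.ne', Real.exp_log (by norm_num)]
  have key : ∀ k : ℕ, ∀ y, P y → ∀ t ≥ (0:ℝ), t ≤ (k + 1) * T →
      N (y t) ≤ 2 * B * Real.exp (-(Real.log 2 / T) * t) * N (y 0) := by
    intro k
    induction k with
    | zero =>
      intro y hy t ht htT
      refine (hP y hy t ht).trans (mul_le_mul_of_nonneg_right ((hbB t ht).trans ?_) (hN _))
      have h1 : Real.exp (-(Real.log 2 / T * T)) ≤ Real.exp (-(Real.log 2 / T) * t) := by
        apply Real.exp_le_exp.2
        have : Real.log 2 / T * t ≤ Real.log 2 / T * T :=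
          mul_le_mul_of_nonneg_left (by simpa using htT) (by positivity)
        linarith
      rw [Real.exp_neg, heT] at h1
      nlinarith
    | succ k ih =>
      intro y hy t ht htT
      by_cases htk : t ≤ (k + 1) * T
      · exact ih y hy t ht htk
      push Not at htk
      have hkT : (0:ℝ) ≤ k * T := by positivity
      push_cast at htT
      have h1 := ih _ (hsh y hy T hT0.le) (t - T) (by linarith) (by linarith)
      simp only [sub_add_cancel, zero_add] at h1
      have h2 : N (y T) ≤ 1/2 * N (y 0) :=
        (hP y hy T hT0.le).trans (mul_le_mul_of_nonneg_right hT (hN _))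
      have h3 : Real.exp (-(Real.log 2 / T) * (t - T)) =
          2 * Real.exp (-(Real.log 2 / T) * t) := by
        rw [← heT, ← Real.exp_add, heT]; congr 1; ring
      rw [h3] at h1
      calc N (y t) ≤ _ := h1
        _ ≤ 2 * B * (2 * Real.exp (-(Real.log 2 / T) * t)) * (1/2 * N (y 0)) := by gcongr
        _ = _ := by ring
  intro y hy t ht
  obtain ⟨k, hk⟩ := exists_nat_ge (t / T)
  refine key k y hy t ht ?_
  rw [div_le_iff₀ hT0] at hk
  linarith

lemma bdd_of_step (f : ℝ → ℝ) (B D lam : ℝ) (hD : 0 ≤ D) (hl : 0 < lam)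
    (hB : ∀ t ∈ Icc (0:ℝ) 1, f t ≤ B)
    (hs : ∀ t ≥ (0:ℝ), f (t + 1) ≤ f t + D * Real.exp (-lam * t)) :
    ∃ C, ∀ t ≥ (0:ℝ), f t ≤ C := by
  have he : Real.exp (-lam) < 1 := by rw [Real.exp_lt_one_iff]; linarith
  set C2 := D / (1 - Real.exp (-lam)) with hC2
  have hC2n : 0 ≤ C2 := div_nonneg hD (by linarith)
  have hC2e : C2 * (1 - Real.exp (-lam)) = D := div_mul_cancel₀ _ (by linarith)
  have key : ∀ k : ℕ, ∀ t ≥ (0:ℝ), t ≤ k + 1 → f t ≤ B + C2 - C2 * Real.exp (-lam * t) := by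
    intro k
    induction k with
    | zero =>
      intro t ht h1
      have := hB t ⟨ht, by simpa using h1⟩
      have h2 : Real.exp (-lam * t) ≤ 1 := by
        rw [Real.exp_le_one_iff]; nlinarith
      nlinarith
    | succ k ih =>
      intro t ht h1
      by_cases htk : t ≤ k + 1
      · exact ih t ht htk
      push Not at htk
      push_cast at h1
      have hk : (0:ℝ) ≤ k := by positivity
      have h2 := ih (t - 1) (by linarith) (by linarith)
      have h3 := hs (t - 1) (by linarith)
      rw [sub_add_cancel] at h3
      have h4 : Real.exp (-lam * t) = Real.exp (-lam * (t - 1)) * Real.exp (-lam) := by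
        rw [← Real.exp_add]; congr 1; ring
      rw [h4]
      rw [← hC2e] at h3
      linarith
  refine ⟨B + C2, fun t ht => ?_⟩
  obtain ⟨k, hk⟩ := exists_nat_ge t
  have := key k t ht (by linarith)
  have h5 : 0 ≤ C2 * Real.exp (-lam * t) := by positivity
  linarith

/-- Consider the linear heat equation `∂x/∂t = Δx + a·x` on `(0,∞) × G`
with Dirichlet boundary input, on an open bounded connected set `G ⊂ ℝⁿ` with smooth
boundary, with state space `X`, admissible input sets `A(x₀)` and (unique) classical
solution map `φ`, satisfying hypothesis (H3). The associated control system is exp-ISS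
with a linear gain function iff it is 0-UGAS. -/
theorem stmt12 {n : ℕ} (G : Set (EuclideanSpace ℝ (Fin n)))
    (hGne : G.Nonempty) (hGopen : IsOpen G) (hGbdd : Bornology.IsBounded G)
    (hGconn : IsConnected G)
    -- `G` has a smooth boundary: it is the sublevel set of a smooth function whose
    -- differential does not vanish on the boundary
    (hGsmooth : ∃ F : EuclideanSpace ℝ (Fin n) → ℝ, ContDiff ℝ (⊤ : ℕ∞) F ∧
      G = F ⁻¹' (Iio 0) ∧ ∀ z ∈ frontier G, fderiv ℝ F z ≠ 0)
    (a : ℝ)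
    (p : ℝ≥0∞) (hp : 1 ≤ p)
    (X : Set (EuclideanSpace ℝ (Fin n) → ℝ))
    (A : (EuclideanSpace ℝ (Fin n) → ℝ) → Set (ℝ → EuclideanSpace ℝ (Fin n) → ℝ))
    (φ : (EuclideanSpace ℝ (Fin n) → ℝ) → (ℝ → EuclideanSpace ℝ (Fin n) → ℝ) →
      ℝ → EuclideanSpace ℝ (Fin n) → ℝ)
    -- the state space (`X = H^{2m+1}(G)` in the paper): a linear subspace of
    -- `C⁰(closure G)` containing the constant functions
    (hXcont : ∀ x ∈ X, ContinuousOn x (closure G))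
    (hXconst : ∀ c : ℝ, (fun _ => c) ∈ X)
    (hXadd : ∀ x ∈ X, ∀ y ∈ X, (fun z => x z + y z) ∈ X)
    (hXsmul : ∀ c : ℝ, ∀ x ∈ X, (fun z => c * x z) ∈ X)
    -- admissible inputs are bounded continuous boundary data compatible with the
    -- initial state, and every constant input compatible with the state is admissible
    (hAne : ∀ x₀ ∈ X, (∃ c : ℝ, ∀ z ∈ frontier G, x₀ z = c) → (A x₀).Nonempty)
    (hAmem : ∀ x₀ ∈ X, ∀ u ∈ A x₀, IsBdryInput G u ∧ ∀ z ∈ frontier G, u 0 z = x₀ z)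
    (hAconst : ∀ x₀ ∈ X, ∀ c : ℝ, (∀ z ∈ frontier G, x₀ z = c) →
      ∀ u : ℝ → EuclideanSpace ℝ (Fin n) → ℝ, IsBdryInput G u →
        (∀ t ≥ (0:ℝ), ∀ z ∈ frontier G, u t z = c) → u ∈ A x₀)
    -- `φ` yields classical solutions of the heat equation with time-slices in `X`
    (hφ : ∀ x₀ ∈ X, ∀ u ∈ A x₀,
      ContinuousOn (fun q : ℝ × EuclideanSpace ℝ (Fin n) => φ x₀ u q.1 q.2)
        (Ici 0 ×ˢ closure G) ∧
      C12On (φ x₀ u) (Ioi 0 ×ˢ G) ∧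
      (∀ t > (0:ℝ), ∀ z ∈ G,
        deriv (fun s => φ x₀ u s z) t = lap (φ x₀ u t) z + a * φ x₀ u t z) ∧
      (∀ z ∈ closure G, φ x₀ u 0 z = x₀ z) ∧
      (∀ t ≥ (0:ℝ), ∀ z ∈ frontier G, φ x₀ u t z = u t z) ∧
      (∀ t ≥ (0:ℝ), φ x₀ u t ∈ X))
    -- `φ x₀ u` is the *unique* classical solution
    (huniq : ∀ x₀ ∈ X, ∀ u ∈ A x₀, ∀ y : ℝ → EuclideanSpace ℝ (Fin n) → ℝ,
      ContinuousOn (fun q : ℝ × EuclideanSpace ℝ (Fin n) => y q.1 q.2)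
        (Ici 0 ×ˢ closure G) →
      C12On y (Ioi 0 ×ˢ G) →
      (∀ t > (0:ℝ), ∀ z ∈ G, deriv (fun s => y s z) t = lap (y t) z + a * y t z) →
      (∀ z ∈ closure G, y 0 z = x₀ z) →
      (∀ t ≥ (0:ℝ), ∀ z ∈ frontier G, y t z = u t z) →
      ∀ t ≥ (0:ℝ), ∀ z ∈ closure G, y t z = φ x₀ u t z)
    -- Hypothesis (H3)
    (hH3 : ∀ δ > (0:ℝ), ∀ c : ℝ, ∀ x ∈ X, ∃ k : EuclideanSpace ℝ (Fin n) → ℝ,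
      ContinuousOn k (closure G) ∧ (∀ z ∈ closure G, k z ∈ Icc (0:ℝ) 1) ∧
      (∀ z ∈ frontier G, k z = 1) ∧
      (∀ z ∈ closure G, δ ≤ Metric.infDist z (frontier G) → k z = 0) ∧
      (fun z => (1 - k z) * x z + c * k z) ∈ X) :
    -- exp-ISS with a linear gain function  ↔  0-UGAS
    (∃ M > (0:ℝ), ∃ lam > (0:ℝ), ∃ g > (0:ℝ),
      ∀ x₀ ∈ X, ∀ u ∈ A x₀, ∀ t ≥ (0:ℝ),
        Xnorm G p (φ x₀ u t) ≤ M * Real.exp (-lam * t) * Xnorm G p x₀ + g * bdryNorm G u) ↔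
    (∃ β : ℝ → ℝ → ℝ, ClassKL β ∧
      ∀ x₀ ∈ X, (fun _ _ => (0:ℝ)) ∈ A x₀ → ∀ t ≥ (0:ℝ),
        Xnorm G p (φ x₀ (fun _ _ => (0:ℝ)) t) ≤ β (Xnorm G p x₀) t) := by
  have hbi : ∀ c : ℝ, IsBdryInput G (fun _ _ => c) := fun c =>
    ⟨continuousOn_const, |c|, fun _ _ _ _ => le_rfl⟩
  have hAc : ∀ x ∈ X, ∀ c : ℝ, (∀ z ∈ frontier G, x z = c) → (fun _ _ => c) ∈ A x :=
    fun x hx c h => hAconst x hx c h _ (hbi c) fun _ _ _ _ => rfl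
  have hfc : frontier G ⊆ closure G := frontier_subset_closure
  have hsol : ∀ x ∈ X, ∀ u ∈ A x, IsSolH G a (φ x u) := fun x hx u hu =>
    ⟨(hφ x hx u hu).1, (hφ x hx u hu).2.1, (hφ x hx u hu).2.2.1⟩
  constructor
  · rintro ⟨M, hM, lam, hlam, g, hg, H⟩
    refine ⟨fun r t => M * Real.exp (-lam * t) * r, ⟨by fun_prop, ?_, ?_⟩, ?_⟩
    · intro t _
      refine ⟨by fun_prop, fun r _ s _ hrs => ?_, by simp⟩
      have : 0 < M * Real.exp (-lam * t) := by positivity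
      exact mul_lt_mul_of_pos_left hrs this
    · intro r hr
      refine ⟨fun s _ t _ hst => ?_, ?_⟩
      · refine mul_lt_mul_of_pos_right (mul_lt_mul_of_pos_left (Real.exp_lt_exp.2 ?_) hM) hr
        nlinarith
      · have h1 : Tendsto (fun t : ℝ => -lam * t) atTop atBot :=
          tendsto_id.const_mul_atTop_of_neg (by linarith)
        have h2 := ((Real.tendsto_exp_atBot.comp h1).const_mul M).mul_const r
        simpa using h2
    · intro x₀ hx₀ h0 t ht
      have h1 := H x₀ hx₀ _ h0 t ht
      have h2 : bdryNorm G (fun _ _ => (0:ℝ)) = 0 := by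
        unfold bdryNorm
        apply le_antisymm
        · apply Real.sSup_le _ le_rfl
          rintro _ ⟨q, _, rfl⟩
          simp
        · apply Real.sSup_nonneg
          rintro _ ⟨q, _, rfl⟩
          simp
      rw [h2] at h1
      simpa using h1
  rintro ⟨β, ⟨hβc, hβK, hβL⟩, hβ⟩
  -- identification of solutions with constant boundary values
  have hid : ∀ y, IsSolH G a y → ∀ x ∈ X, (∀ z ∈ closure G, y 0 z = x z) → ∀ c : ℝ,
      (∀ t ≥ (0:ℝ), ∀ z ∈ frontier G, y t z = c) →
      (fun _ _ => c) ∈ A x ∧ ∀ t ≥ (0:ℝ), ∀ z ∈ closure G, y t z = φ x (fun _ _ => c) t z := by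
    intro y hy x hx h0 c hb
    have hm : (fun _ _ => c) ∈ A x := hAc x hx c fun z hz => by
      rw [← h0 z (hfc hz), hb 0 le_rfl z hz]
    exact ⟨hm, huniq x hx _ hm y hy.1 hy.2.1 hy.2.2 h0 hb⟩
  let P : (ℝ → EuclideanSpace ℝ (Fin n) → ℝ) → Prop := fun y =>
    IsSolH G a y ∧ (∃ x ∈ X, ∀ z ∈ closure G, y 0 z = x z) ∧
      ∀ t ≥ (0:ℝ), ∀ z ∈ frontier G, y t z = 0
  have hPsmul : ∀ y, P y → ∀ c : ℝ, P (fun t z => c * y t z) := by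
    rintro y ⟨h1, ⟨x, hx, h2⟩, h3⟩ c
    exact ⟨h1.smul c, ⟨_, hXsmul c x hx, fun z hz => by simp only [h2 z hz]⟩,
      fun t ht z hz => by simp only [h3 t ht z hz, mul_zero]⟩
  have hPsh : ∀ y, P y → ∀ T ≥ (0:ℝ), P (fun t => y (t + T)) := by
    rintro y ⟨h1, ⟨x, hx, h2⟩, h3⟩ T hT
    obtain ⟨hm, he⟩ := hid y h1 x hx h2 0 h3
    refine ⟨h1.shift hT, ⟨_, (hφ x hx _ hm).2.2.2.2.2 T hT, fun z hz => ?_⟩,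
      fun t ht z hz => h3 _ (by linarith) z hz⟩
    simp only [zero_add]; exact he T hT z hz
  have hPβ : ∀ y, P y → ∀ t ≥ (0:ℝ), Xnorm G p (y t) ≤ β (Xnorm G p (y 0)) t := by
    rintro y ⟨h1, ⟨x, hx, h2⟩, h3⟩ t ht
    obtain ⟨hm, he⟩ := hid y h1 x hx h2 0 h3
    rw [Xnorm_congr hGopen p (he t ht), Xnorm_congr hGopen p h2]
    exact hβ x hx hm t ht
  have hPlin : ∀ y, P y → ∀ t ≥ (0:ℝ), Xnorm G p (y t) ≤ β 1 t * Xnorm G p (y 0) := by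
    intro y hy t ht
    rcases (Xnorm_nonneg G p (y 0)).eq_or_lt with h | h
    · have h1 := hPβ y hy t ht
      have h2 : β 0 t = 0 := (hβK t ht).2.2
      rw [← h, h2] at h1
      rw [← h]; simpa using h1
    · have h1 := hPβ _ (hPsmul y hy (Xnorm G p (y 0))⁻¹) t ht
      rw [Xnorm_smul, Xnorm_smul, abs_of_pos (inv_pos.2 h), inv_mul_cancel₀ h.ne',
        inv_mul_le_iff₀ h] at h1
      linarith
  have hB : 0 < β 1 0 := by
    have h1 := hβK 0 le_rfl
    have h2 := h1.2.1 (mem_Ici.2 le_rfl) (mem_Ici.2 zero_le_one) zero_lt_one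
    have h3 := h1.2.2
    simp only at h2 h3
    linarith
  obtain ⟨M, hM, lam, hlam, hdec⟩ := exp_decay P (Xnorm G p) (Xnorm_nonneg G p) hPsh (β 1) (β 1 0)
    hB (fun t ht => (hβL 1 one_pos).1.antitoneOn (mem_Ici.2 le_rfl) (mem_Ici.2 ht) ht)
    (hβL 1 one_pos).2 hPlin
  -- boundedness of the response to the constant input 1
  have hm1 := hAc _ (hXconst 1) 1 fun _ _ => rfl
  obtain ⟨w, hw⟩ : ∃ w, w = φ (fun _ => 1) (fun _ _ => (1:ℝ)) := ⟨_, rfl⟩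
  have hwφ := hφ _ (hXconst 1) _ hm1
  have hws : IsSolH G a w := by rw [hw]; exact hsol _ (hXconst 1) _ hm1
  rw [← hw] at hwφ
  obtain ⟨-, -, -, hw0, hwb, hwX⟩ := hwφ
  set K := Xnorm G p (fun _ => (1:ℝ)) with hK
  have hKn : 0 ≤ K := Xnorm_nonneg _ _ _
  have hKd : ∀ d : ℝ, 0 ≤ d → Xnorm G p (fun _ => d) = d * K := by
    intro d hd
    have := Xnorm_smul G p d (fun _ => (1:ℝ))
    rw [abs_of_nonneg hd] at this
    simpa using this
  obtain ⟨W, hW⟩ : ∃ W, ∀ t ≥ (0:ℝ), Xnorm G p (w t) ≤ W := by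
    have hcpt : IsCompact (Icc (0:ℝ) 1 ×ˢ closure G) :=
      isCompact_Icc.prod hGbdd.isCompact_closure
    obtain ⟨B, hBd⟩ := hcpt.exists_bound_of_continuousOn
      (hws.1.mono (prod_mono Icc_subset_Ici_self subset_rfl))
    have hPd : P (fun t z => w (t + 1) z + (-1) * w t z) := by
      refine ⟨(hws.shift zero_le_one).add hGopen (hws.smul (-1)), ⟨_,
        hXadd _ (hwX 1 zero_le_one) _ (hXsmul (-1) _ (hwX 0 le_rfl)), fun z _ => ?_⟩, ?_⟩
      · simp only [zero_add]
      · intro t ht z hz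
        simp only
        rw [hwb t ht z hz, hwb (t+1) (by linarith) z hz]; norm_num
    refine bdd_of_step _ (|B| * K)
      (M * Xnorm G p (fun z => w (0 + 1) z + (-1) * w 0 z)) lam
      (mul_nonneg hM.le (Xnorm_nonneg _ _ _)) hlam ?_ ?_
    · intro t ht
      rw [← hKd _ (abs_nonneg _)]
      refine Xnorm_mono hGopen hGbdd p continuousOn_const fun z hz => ?_
      exact (hBd (t, z) ⟨ht, hz⟩).trans ((le_abs_self _).trans (le_abs_self _))
    · intro t ht
      have h1 := hdec _ hPd t ht
      have h2 : Xnorm G p (w (t + 1)) ≤ Xnorm G p (w t) +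
          Xnorm G p (fun z => w (t + 1) z + (-1) * w t z) := by
        refine Xnorm_dom hGopen hGbdd hp (hws.slice ht)
          (((hws.shift zero_le_one).add hGopen (hws.smul (-1))).slice ht) fun z _ => ?_
        calc |w (t+1) z| = |w t z + (w (t + 1) z + (-1) * w t z)| := by congr 1; ring
          _ ≤ _ := abs_add_le _ _
      linarith
  have hWn : 0 ≤ W := (Xnorm_nonneg _ _ _).trans (hW 0 le_rfl)
  -- response to constant inputs
  have hconst : ∀ x ∈ X, ∀ d ≥ (0:ℝ), (∀ z ∈ frontier G, x z = d) → ∀ t ≥ (0:ℝ),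
      Xnorm G p (φ x (fun _ _ => d) t) ≤
        M * Real.exp (-lam * t) * (Xnorm G p x + d * K) + d * W := by
    intro x hx d hd hxd t ht
    have hm := hAc x hx d hxd
    have hy := hsol x hx _ hm
    obtain ⟨-, -, -, hy0, hyb, -⟩ := hφ x hx _ hm
    have hPd : P (fun t z => φ x (fun _ _ => d) t z + (-d) * w t z) := by
      refine ⟨hy.add hGopen (hws.smul (-d)), ⟨_, hXadd _ hx _ (hXconst (-d)), fun z hz => ?_⟩, ?_⟩
      · simp only [hy0 z hz, hw0 z hz, mul_one]
      · intro t ht z hz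
        simp only
        rw [hyb t ht z hz, hwb t ht z hz]; ring
    have h1 := hdec _ hPd t ht
    have h2 : Xnorm G p (fun z => φ x (fun _ _ => d) 0 z + (-d) * w 0 z) ≤
        Xnorm G p x + d * K := by
      rw [← hKd d hd]
      refine Xnorm_dom hGopen hGbdd hp (hXcont x hx) continuousOn_const fun z hz => ?_
      rw [hy0 z hz, hw0 z hz, mul_one]
      exact (abs_add_le _ _).trans (by rw [abs_neg])
    have h3 : Xnorm G p (φ x (fun _ _ => d) t) ≤
        Xnorm G p (fun z => φ x (fun _ _ => d) t z + (-d) * w t z) +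
          Xnorm G p (fun z => d * w t z) := by
      refine Xnorm_dom hGopen hGbdd hp ((hy.add hGopen (hws.smul (-d))).slice ht)
        ((hws.smul d).slice ht) fun z _ => ?_
      refine le_trans (le_of_eq ?_) (abs_add_le _ _)
      congr 1; ring
    rw [Xnorm_smul, abs_of_nonneg hd] at h3
    have h4 : d * Xnorm G p (w t) ≤ d * W := mul_le_mul_of_nonneg_left (hW t ht) hd
    have h5 := mul_le_mul_of_nonneg_left h2
      (show 0 ≤ M * Real.exp (-lam * t) by positivity)
    linarith
  -- comparison from above
  have hup : (frontier G).Nonempty → ∀ y, IsSolH G a y → ∀ x ∈ X,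
      (∀ z ∈ closure G, y 0 z = x z) → ∀ c d : ℝ, 0 ≤ c → c < d →
      (∀ t ≥ (0:ℝ), ∀ z ∈ frontier G, y t z ≤ c) →
      ∃ x' ∈ X, (∀ z ∈ frontier G, x' z = d) ∧ (∀ z ∈ closure G, |x' z| ≤ |x z| + |d|) ∧
        ∀ t ≥ (0:ℝ), ∀ z ∈ closure G, y t z ≤ φ x' (fun _ _ => d) t z := by
    intro hne y hy x hx h0 c d hc hcd hb
    have huc := hGbdd.isCompact_closure.uniformContinuousOn_of_continuous (hXcont x hx)
    rw [Metric.uniformContinuousOn_iff] at huc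
    obtain ⟨δ, hδ, hdel⟩ := huc (d - c) (by linarith)
    obtain ⟨k, -, hk01, hk1, hk0, hkX⟩ := hH3 δ hδ d x hx
    have hbd : ∀ z ∈ frontier G, (1 - k z) * x z + d * k z = d := fun z hz => by
      rw [hk1 z hz]; ring
    have hm := hAc _ hkX d hbd
    have hys := hsol _ hkX _ hm
    obtain ⟨-, -, -, hy0, hyb, -⟩ := hφ _ hkX _ hm
    refine ⟨_, hkX, hbd, fun z hz => ?_, ?_⟩
    · obtain ⟨hk, hk'⟩ := hk01 z hz
      refine (abs_add_le _ _).trans (add_le_add ?_ ?_)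
      · rw [abs_mul, abs_of_nonneg (by linarith : 0 ≤ 1 - k z)]
        exact mul_le_of_le_one_left (abs_nonneg _) (by linarith)
      · rw [abs_mul, abs_of_nonneg hk]
        exact mul_le_of_le_one_right (abs_nonneg _) hk'
    · have hmp := max_principle hGopen hGbdd (hy.add hGopen (hys.smul (-1))) ?_ ?_
      · intro t ht z hz
        have := hmp t ht z hz
        linarith
      · intro z hz
        simp only [h0 z hz, hy0 z hz]
        by_cases hzd : δ ≤ Metric.infDist z (frontier G)
        · rw [hk0 z hz hzd]; linarith
        · push Not at hzd
          obtain ⟨z', hz', hdist⟩ := (Metric.infDist_lt_iff hne).1 hzd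
          have h1 := hdel z hz z' (hfc hz') hdist
          have h2 := hb 0 le_rfl z' hz'
          rw [h0 z' (hfc hz')] at h2
          rw [Real.dist_eq] at h1
          have h3 := (abs_lt.1 h1).2
          have h4 : x z ≤ d := by linarith
          have h5 := (hk01 z hz).1
          nlinarith
      · intro t ht z hz
        simp only [hyb t ht z hz]
        have := hb t ht z hz
        linarith
  have hbn : ∀ u, 0 ≤ bdryNorm G u := fun u => by
    apply Real.sSup_nonneg
    rintro _ ⟨q, _, rfl⟩
    exact abs_nonneg _
  refine ⟨2 * M, by positivity, lam, hlam, 4 * M * K + 2 * W + 1, by positivity, ?_⟩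
  intro x hx u hu t ht
  have hy := hsol x hx u hu
  obtain ⟨-, -, -, hy0, hyb, -⟩ := hφ x hx u hu
  have hEpos : 0 < Real.exp (-lam * t) := Real.exp_pos _
  have hE1 : Real.exp (-lam * t) ≤ 1 := by
    rw [Real.exp_le_one_iff]; nlinarith
  have hxn := Xnorm_nonneg G p x
  rcases (frontier G).eq_empty_or_nonempty with hemp | hne
  · have hPy : P (φ x u) := ⟨hy, ⟨x, hx, hy0⟩, fun t _ z hz => by simp [hemp] at hz⟩
    have h1 := hdec _ hPy t ht
    rw [Xnorm_congr hGopen p hy0] at h1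
    have h2 : 0 ≤ (4 * M * K + 2 * W + 1) * bdryNorm G u := mul_nonneg (by positivity) (hbn u)
    have h3 : 0 ≤ M * Real.exp (-lam * t) * Xnorm G p x := by positivity
    linarith
  have hub : ∀ t ≥ (0:ℝ), ∀ z ∈ frontier G, |φ x u t z| ≤ bdryNorm G u := by
    intro t ht z hz
    rw [hyb t ht z hz]
    obtain ⟨⟨-, C, hC⟩, -⟩ := hAmem x hx u hu
    refine le_csSup ⟨C, ?_⟩ ⟨(t, z), ⟨ht, hz⟩, rfl⟩
    rintro _ ⟨q, hq, rfl⟩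
    exact hC q.1 hq.1 q.2 hq.2
  -- the bound for every `d` above the sup-norm of the input
  have hd : ∀ d > bdryNorm G u, Xnorm G p (φ x u t) ≤
      2 * M * Real.exp (-lam * t) * Xnorm G p x + (4 * M * K + 2 * W + 1) * d := by
    intro d hdc
    have hd0 : 0 ≤ d := (hbn u).trans hdc.le
    obtain ⟨x₁, hx₁, hb₁, hn₁, hc₁⟩ := hup hne _ hy x hx hy0 _ d (hbn u) hdc
      fun t ht z hz => (abs_le.1 (hub t ht z hz)).2
    obtain ⟨x₂, hx₂, hb₂, hn₂, hc₂⟩ := hup hne _ (hy.smul (-1)) _ (hXsmul (-1) x hx)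
      (fun z hz => by simp only [hy0 z hz]) _ d (hbn u) hdc
      fun t ht z hz => by have := (abs_le.1 (hub t ht z hz)).1; linarith
    have hX : ∀ x' ∈ X, (∀ z ∈ closure G, |x' z| ≤ |x z| + |d|) →
        Xnorm G p x' ≤ Xnorm G p x + d * K := fun x' _ h => by
      rw [← hKd d hd0]
      exact Xnorm_dom hGopen hGbdd hp (hXcont x hx) continuousOn_const h
    have e1 := hX x₁ hx₁ hn₁
    have e2 := hX x₂ hx₂ (by simpa using hn₂)
    have g1 := hconst x₁ hx₁ d hd0 hb₁ t ht
    have g2 := hconst x₂ hx₂ d hd0 hb₂ t ht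
    have s1 := hsol x₁ hx₁ _ (hAc x₁ hx₁ d hb₁)
    have s2 := hsol x₂ hx₂ _ (hAc x₂ hx₂ d hb₂)
    have h := Xnorm_dom hGopen hGbdd hp (w := φ x u t) (s1.slice ht) (s2.slice ht) fun z hz => by
      have a1 := hc₁ t ht z hz
      have a2 := hc₂ t ht z hz
      have b1 := le_abs_self (φ x₁ (fun _ _ => d) t z)
      have b2 := le_abs_self (φ x₂ (fun _ _ => d) t z)
      have b3 := abs_nonneg (φ x₁ (fun _ _ => d) t z)
      have b4 := abs_nonneg (φ x₂ (fun _ _ => d) t z)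
      rw [abs_le]
      constructor <;> linarith
    have hME : 0 ≤ M * Real.exp (-lam * t) := by positivity
    have f1 := mul_le_mul_of_nonneg_left e1 hME
    have f2 := mul_le_mul_of_nonneg_left e2 hME
    have f3 : M * Real.exp (-lam * t) * (d * K) ≤ M * (d * K) :=
      mul_le_mul_of_nonneg_right (mul_le_of_le_one_right hM.le hE1) (by positivity)
    linarith
  set gg := 4 * M * K + 2 * W + 1 with hgg
  have hgpos : 0 < gg := by positivity
  apply _root_.le_of_forall_pos_le_add
  intro ε hε
  have := hd (bdryNorm G u + ε / gg) (by linarith [div_pos hε hgpos])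
  rw [mul_add, mul_div_cancel₀ _ hgpos.ne'] at this
  linarith

end
end

section
/- Consider the forward-complete ODE system ẋ = f(x,u) which is monotone with respect to inputs. Then the system is ISS, i.e. there exist β of class KL and γ of class K with |φ(t,x₀,u)| ≤ β(|x₀|,t) + γ(‖u‖_∞) for all x₀ ∈ ℝⁿ, all essentially bounded measurable u : ℝ≥0 → ℝ^m and all t ≥ 0, if and only if it is ISS with respect to inputs that are constant in time, i.e. there exist β' of class KL and γ' of class K with |φ(t,x₀,k)| ≤ β'(|x₀|,t) + γ'(|k|) for all x₀ ∈ ℝⁿ, all constant inputs k ∈ ℝ^m and all t ≥ 0. -/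
open Filter Set MeasureTheory

noncomputable section

/-- An admissible input: an essentially bounded measurable function `u : ℝ≥0 → ℝ^m`. -/
def IsInput {m : ℕ} (u : ℝ → EuclideanSpace ℝ (Fin m)) : Prop :=
  AEStronglyMeasurable u (volume.restrict (Ici 0)) ∧
  ∃ C : ℝ, ∀ᵐ t ∂(volume.restrict (Ici (0:ℝ))), ‖u t‖ ≤ C

/-- The essential supremum norm `‖u‖_∞ = ess sup_{t ≥ 0} |u(t)|`. -/
def supNorm {m : ℕ} (u : ℝ → EuclideanSpace ℝ (Fin m)) : ℝ :=
  (eLpNorm u ⊤ (volume.restrict (Ici (0:ℝ)))).toReal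

lemma isInput_const_aux {m : ℕ} (k : EuclideanSpace ℝ (Fin m)) : IsInput (fun _ : ℝ => k) :=
  ⟨aestronglyMeasurable_const, ‖k‖, Eventually.of_forall fun _ => le_rfl⟩

lemma supNorm_const_aux {m : ℕ} (k : EuclideanSpace ℝ (Fin m)) :
    supNorm (fun _ : ℝ => k) = ‖k‖ := by
  unfold supNorm
  rw [eLpNorm_const k (by simp) (by simp)]
  simp

lemma ae_le_supNorm_aux {m : ℕ} (u : ℝ → EuclideanSpace ℝ (Fin m)) (hu : IsInput u) :
    ∀ᵐ s ∂(volume.restrict (Ici (0:ℝ))), ‖u s‖ ≤ supNorm u := by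
  obtain ⟨hm, C, hC⟩ := hu
  have hfin : eLpNorm u ⊤ (volume.restrict (Ici (0:ℝ))) ≠ ⊤ :=
    (memLp_top_of_bound hm C hC).eLpNorm_ne_top
  filter_upwards [ae_le_eLpNormEssSup (f := u) (μ := volume.restrict (Ici (0:ℝ)))] with s hs
  rw [← eLpNorm_exponent_top] at hs
  have := ENNReal.toReal_mono hfin hs
  simpa [supNorm] using this

lemma norm_le_aux {n : ℕ} (x : EuclideanSpace ℝ (Fin n)) (B : ℝ) (h : ∀ i, |x i| ≤ B) :
    ‖x‖ ≤ n * B := by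
  have h1 : ‖x‖ ≤ ∑ i, ‖x i‖ := by
    rw [EuclideanSpace.norm_eq]
    refine Real.sqrt_le_iff.2 ⟨Finset.sum_nonneg fun i _ => norm_nonneg _, ?_⟩
    exact Finset.sum_sq_le_sq_sum_of_nonneg fun i _ => norm_nonneg _
  refine h1.trans ((Finset.sum_le_sum fun i _ => h i).trans ?_)
  simp

/-- A forward-complete ODE system `ẋ = f(x,u)` that is monotone with
respect to inputs is ISS iff it is ISS with respect to constant-in-time inputs. -/
theorem stmt13 {n m : ℕ}
    (f : EuclideanSpace ℝ (Fin n) → EuclideanSpace ℝ (Fin m) → EuclideanSpace ℝ (Fin n))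
    (hfc : Continuous fun q : EuclideanSpace ℝ (Fin n) × EuclideanSpace ℝ (Fin m) =>
      f q.1 q.2)
    (hflip : ∃ L : NNReal, ∀ u : EuclideanSpace ℝ (Fin m), LipschitzWith L fun x => f x u)
    (φ : ℝ → EuclideanSpace ℝ (Fin n) → (ℝ → EuclideanSpace ℝ (Fin m)) →
      EuclideanSpace ℝ (Fin n))
    -- forward completeness: `φ` is a (Carathéodory) solution of the ODE for every
    -- initial state and every admissible input
    (hsol : ∀ (x₀ : EuclideanSpace ℝ (Fin n)) (u : ℝ → EuclideanSpace ℝ (Fin m)),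
      IsInput u → φ 0 x₀ u = x₀ ∧
        ∀ t ≥ (0:ℝ),
          IntervalIntegrable (fun s => f (φ s x₀ u) (u s)) volume 0 t ∧
          φ t x₀ u = x₀ + ∫ s in (0:ℝ)..t, f (φ s x₀ u) (u s))
    -- monotonicity with respect to inputs (componentwise order)
    (hmono : ∀ t ≥ (0:ℝ), ∀ (x₀ : EuclideanSpace ℝ (Fin n))
      (u₁ u₂ : ℝ → EuclideanSpace ℝ (Fin m)), IsInput u₁ → IsInput u₂ →
      (∀ᵐ s ∂(volume.restrict (Ici (0:ℝ))), ∀ i, u₁ s i ≤ u₂ s i) →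
      ∀ i, φ t x₀ u₁ i ≤ φ t x₀ u₂ i) :
    (∃ β γ, ClassKL β ∧ ClassK γ ∧
      ∀ (x₀ : EuclideanSpace ℝ (Fin n)) (u : ℝ → EuclideanSpace ℝ (Fin m)), IsInput u →
        ∀ t ≥ (0:ℝ), ‖φ t x₀ u‖ ≤ β ‖x₀‖ t + γ (supNorm u)) ↔
    (∃ β' γ', ClassKL β' ∧ ClassK γ' ∧
      ∀ (x₀ : EuclideanSpace ℝ (Fin n)) (k : EuclideanSpace ℝ (Fin m)),
        ∀ t ≥ (0:ℝ), ‖φ t x₀ (fun _ => k)‖ ≤ β' ‖x₀‖ t + γ' ‖k‖) := by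
  constructor
  · rintro ⟨β, γ, hβ, hγ, h⟩
    refine ⟨β, γ, hβ, hγ, fun x₀ k t ht => ?_⟩
    have h1 := h x₀ (fun _ => k) (isInput_const_aux k) t ht
    rwa [supNorm_const_aux] at h1
  · rintro ⟨β, γ, hβ, hγ, h⟩
    have hn : (0:ℝ) < (n:ℝ) + 1 := by positivity
    have hm : (0:ℝ) < (m:ℝ) + 1 := by positivity
    have hγ2 : ClassK fun r => ((n:ℝ) + 1) * γ (((m:ℝ) + 1) * r) := by
      obtain ⟨h1, h2, h3⟩ := hγ
      refine ⟨?_, ?_, by simp [h3]⟩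
      · refine continuousOn_const.mul (h1.comp (by fun_prop) ?_)
        intro r hr
        exact mul_nonneg hm.le hr
      · intro a ha b hb hab
        refine mul_lt_mul_of_pos_left ?_ hn
        exact h2 (mul_nonneg hm.le ha) (mul_nonneg hm.le hb) (mul_lt_mul_of_pos_left hab hm)
    refine ⟨fun r t => ((n:ℝ) + 1) * β r t, fun r => ((n:ℝ) + 1) * γ (((m:ℝ) + 1) * r),
      ⟨?_, ?_, ?_⟩, hγ2, ?_⟩
    · exact continuousOn_const.mul hβ.1
    · intro t ht
      obtain ⟨h1, h2, h3⟩ := hβ.2.1 t ht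
      refine ⟨continuousOn_const.mul h1, ?_, ?_⟩
      · intro a ha b hb hab
        exact mul_lt_mul_of_pos_left (h2 ha hb hab) hn
      · simp only at h3
        simp [h3]
    · intro r hr
      obtain ⟨h1, h2⟩ := hβ.2.2 r hr
      refine ⟨?_, ?_⟩
      · intro a ha b hb hab
        exact mul_lt_mul_of_pos_left (h1 ha hb hab) hn
      · simpa using h2.const_mul ((n:ℝ) + 1)
    · intro x₀ u hu t ht
      set c := supNorm u with hc
      have hc0 : 0 ≤ c := ENNReal.toReal_nonneg
      have hk : ∀ a : ℝ, |a| = c →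
          ‖φ t x₀ (fun _ => WithLp.toLp 2 (fun _ : Fin m => a))‖
            ≤ β ‖x₀‖ t + γ (((m:ℝ) + 1) * c) := by
        intro a ha
        refine (h x₀ _ t ht).trans ?_
        have : ‖(WithLp.toLp 2 (fun _ : Fin m => a) : EuclideanSpace ℝ (Fin m))‖
            ≤ ((m:ℝ) + 1) * c := by
          refine (norm_le_aux _ c fun i => ?_).trans ?_
          · simp [ha]
          · nlinarith
        have := hγ.2.1.monotoneOn (norm_nonneg _) (mul_nonneg hm.le hc0) this
        linarith
      have hae := ae_le_supNorm_aux u hu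
      have hup := hmono t ht x₀ u (fun _ => WithLp.toLp 2 (fun _ : Fin m => c)) hu
        (isInput_const_aux _) (by
          filter_upwards [hae] with s hs i
          exact (le_abs_self _).trans ((PiLp.norm_apply_le (u s) i).trans hs))
      have hlo := hmono t ht x₀ (fun _ => WithLp.toLp 2 (fun _ : Fin m => -c)) u
        (isInput_const_aux _) hu (by
          filter_upwards [hae] with s hs i
          have := (neg_abs_le (u s i))
          have h2 : |u s i| ≤ c := (PiLp.norm_apply_le (u s) i).trans hs
          show -c ≤ u s i
          linarith)
      have hB1 := hk c (abs_of_nonneg hc0)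
      have hB2 := hk (-c) (by rw [abs_neg, abs_of_nonneg hc0])
      have hB0 : 0 ≤ β ‖x₀‖ t + γ (((m:ℝ) + 1) * c) := (norm_nonneg _).trans hB1
      refine (norm_le_aux (φ t x₀ u) (β ‖x₀‖ t + γ (((m:ℝ) + 1) * c)) fun i => ?_).trans ?_
      · have h1 := (PiLp.norm_apply_le (φ t x₀ (fun _ => WithLp.toLp 2 (fun _ : Fin m => c))) i)
        have h2 := (PiLp.norm_apply_le (φ t x₀ (fun _ => WithLp.toLp 2 (fun _ : Fin m => -c))) i)
        rw [Real.norm_eq_abs, abs_le] at h1 h2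
        rw [abs_le]
        have := hup i
        have := hlo i
        constructor <;> linarith
      · show _ ≤ ((n:ℝ) + 1) * β ‖x₀‖ t + ((n:ℝ) + 1) * γ (((m:ℝ) + 1) * c)
        nlinarith

end
end
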